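/- Let n ≥ 3 be an integer and set m = n − 1. Let λ, c, d : {1,…,m} → ℝ be families of real numbers satisfying Σ_α d_α = 8·Σ_α λ_α² − Σ_α c_α. Then ∫_{ℝ^m} e^{−‖ξ‖} [ (1/8)(1 + 1/‖ξ‖)·Σ_{α,β} λ_α λ_β (1 − ξ_α²/‖ξ‖²)(1 − ξ_β²/‖ξ‖²) + (1/(2‖ξ‖⁵))·Σ_{α,β} λ_α λ_β ξ_α² ξ_β² − (1/(8‖ξ‖³))·Σ_α d_α ξ_α² + (1/(2‖ξ‖))·Σ_α λ_α² − (1/(8‖ξ‖))·Σ_α c_α − (1/(4‖ξ‖))·Σ_{α,β} λ_α λ_β (1 − ξ_β²/‖ξ‖²) ] dξ = (V_m · Γ(n−2)/8) · [ ( n − 5 + 2/(n−1) + (n+3)/(n²−1) )·( Σ_α λ_α )² + ( (2n+6)/(n²−1) + 4 − 8/(n−1) )·Σ_α λ_α² − ((n−2)/(n−1))·Σ_α c_α ]. -/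

import Mathlib

open Real MeasureTheory

section helpers
variable {m : ℕ}

lemma aux_meas (u : EuclideanSpace ℝ (Fin m)) (k : ℕ) :
    Measurable (fun ξ : EuclideanSpace ℝ (Fin m) => (inner ℝ u ξ / ‖ξ‖) ^ k) := by
  have h : Measurable (fun ξ : EuclideanSpace ℝ (Fin m) => inner ℝ u ξ) :=
    (continuous_const.inner continuous_id).measurable
  exact (h.div measurable_norm).pow_const k

lemma aux_rot (w : ℝ → ℝ) (k : ℕ) (u v : EuclideanSpace ℝ (Fin m)) (h : ‖u‖ = ‖v‖) :
    ∫ ξ : EuclideanSpace ℝ (Fin m), w ‖ξ‖ * (inner ℝ u ξ / ‖ξ‖) ^ k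
      = ∫ ξ : EuclideanSpace ℝ (Fin m), w ‖ξ‖ * (inner ℝ v ξ / ‖ξ‖) ^ k := by
  set R := (ℝ ∙ (u - v))ᗮ.reflection with hR
  have hRu : R u = v := Submodule.reflection_sub h
  have := (R.measurePreserving).integral_comp R.toHomeomorph.measurableEmbedding
    (fun ξ : EuclideanSpace ℝ (Fin m) => w ‖ξ‖ * (inner ℝ v ξ / ‖ξ‖) ^ k)
  rw [← this]
  congr 1
  ext ξ
  rw [← hRu, R.norm_map, R.inner_map_map]

lemma aux_int (w : ℝ → ℝ) (hw : Integrable (fun ξ : EuclideanSpace ℝ (Fin m) => w ‖ξ‖))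
    (α : Fin m) :
    Integrable (fun ξ : EuclideanSpace ℝ (Fin m) => w ‖ξ‖ * ((ξ α) ^ 2 / ‖ξ‖ ^ 2)) := by
  refine Integrable.mul_bdd (c := 1) hw ?_ ?_
  · exact (by fun_prop : Measurable (fun ξ : EuclideanSpace ℝ (Fin m) => (ξ α) ^ 2 / ‖ξ‖ ^ 2)).aestronglyMeasurable
  · refine Filter.Eventually.of_forall fun ξ => ?_
    rw [Real.norm_of_nonneg (by positivity)]
    apply div_le_one_of_le₀ _ (by positivity)
    have := PiLp.norm_apply_le ξ α
    rw [← sq_abs]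
    exact pow_le_pow_left₀ (abs_nonneg _) this 2

lemma aux_int2 (w : ℝ → ℝ) (hw : Integrable (fun ξ : EuclideanSpace ℝ (Fin m) => w ‖ξ‖))
    (α β : Fin m) :
    Integrable (fun ξ : EuclideanSpace ℝ (Fin m) =>
      w ‖ξ‖ * ((ξ α) ^ 2 / ‖ξ‖ ^ 2) * ((ξ β) ^ 2 / ‖ξ‖ ^ 2)) := by
  refine Integrable.mul_bdd (c := 1) (aux_int w hw α) ?_ ?_
  · exact (by fun_prop : Measurable (fun ξ : EuclideanSpace ℝ (Fin m) => (ξ β) ^ 2 / ‖ξ‖ ^ 2)).aestronglyMeasurable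
  · refine Filter.Eventually.of_forall fun ξ => ?_
    rw [Real.norm_of_nonneg (by positivity)]
    apply div_le_one_of_le₀ _ (by positivity)
    have := PiLp.norm_apply_le ξ β
    rw [← sq_abs]
    exact pow_le_pow_left₀ (abs_nonneg _) this 2

/-- the coordinate quotients sum to one away from the origin -/
lemma aux_sum (ξ : EuclideanSpace ℝ (Fin m)) (h : ξ ≠ 0) :
    ∑ α, (ξ α) ^ 2 / ‖ξ‖ ^ 2 = 1 := by
  rw [← Finset.sum_div, EuclideanSpace.norm_sq_eq]
  simp only [Real.norm_eq_abs, sq_abs]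
  apply div_self
  intro h0
  apply h
  have : ‖ξ‖ ^ 2 = 0 := by rw [EuclideanSpace.norm_sq_eq]; simpa using h0
  simpa using this

lemma aux_ae (hm : 2 ≤ m) : ∀ᵐ ξ : EuclideanSpace ℝ (Fin m), ξ ≠ 0 := by
  have : Nonempty (Fin m) := ⟨⟨0, by omega⟩⟩
  exact Measure.ae_ne volume 0

lemma aux_A (hm : 2 ≤ m) (w : ℝ → ℝ)
    (hw : Integrable (fun ξ : EuclideanSpace ℝ (Fin m) => w ‖ξ‖)) (α : Fin m) :
    ∫ ξ : EuclideanSpace ℝ (Fin m), w ‖ξ‖ * ((ξ α) ^ 2 / ‖ξ‖ ^ 2)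
      = (∫ ξ : EuclideanSpace ℝ (Fin m), w ‖ξ‖) / m := by
  have hrot : ∀ β : Fin m, ∫ ξ : EuclideanSpace ℝ (Fin m), w ‖ξ‖ * ((ξ β) ^ 2 / ‖ξ‖ ^ 2)
      = ∫ ξ : EuclideanSpace ℝ (Fin m), w ‖ξ‖ * ((ξ α) ^ 2 / ‖ξ‖ ^ 2) := by
    intro β
    have := aux_rot w 2 (EuclideanSpace.single β (1:ℝ)) (EuclideanSpace.single α (1:ℝ)) (by simp)
    simpa [EuclideanSpace.inner_single_left, div_pow] using this
  have hs : ∫ ξ : EuclideanSpace ℝ (Fin m), w ‖ξ‖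
      = ∑ β, ∫ ξ : EuclideanSpace ℝ (Fin m), w ‖ξ‖ * ((ξ β) ^ 2 / ‖ξ‖ ^ 2) := by
    rw [← integral_finsetSum _ (fun β _ => aux_int w hw β)]
    apply integral_congr_ae
    filter_upwards [aux_ae hm] with ξ hξ
    rw [← Finset.mul_sum, aux_sum ξ hξ, mul_one]
  rw [hs, Finset.sum_congr rfl (fun β _ => hrot β)]
  have : (m : ℝ) ≠ 0 := by positivity
  simp
  field_simp

lemma aux_B (hm : 2 ≤ m) (w : ℝ → ℝ)
    (hw : Integrable (fun ξ : EuclideanSpace ℝ (Fin m) => w ‖ξ‖)) (α β : Fin m) :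
    ∫ ξ : EuclideanSpace ℝ (Fin m), w ‖ξ‖ * ((ξ α) ^ 2 / ‖ξ‖ ^ 2) * ((ξ β) ^ 2 / ‖ξ‖ ^ 2)
      = (1 + if α = β then 2 else 0) * ((∫ ξ : EuclideanSpace ℝ (Fin m), w ‖ξ‖) / (m * (m + 2))) := by
  set B : Fin m → Fin m → ℝ := fun α β =>
    ∫ ξ : EuclideanSpace ℝ (Fin m), w ‖ξ‖ * ((ξ α) ^ 2 / ‖ξ‖ ^ 2) * ((ξ β) ^ 2 / ‖ξ‖ ^ 2) with hB
  set F := B α α with hF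
  have hdiag' : ∀ γ, B γ γ = ∫ ξ : EuclideanSpace ℝ (Fin m), w ‖ξ‖ *
      (inner ℝ (EuclideanSpace.single γ (1:ℝ)) ξ / ‖ξ‖) ^ 4 := by
    intro γ
    simp only [hB]
    congr 1
    ext ξ
    simp [EuclideanSpace.inner_single_left]
    ring
  have hdiag : ∀ γ, B γ γ = F := by
    intro γ
    rw [hF, hdiag', hdiag']
    exact aux_rot w 4 _ _ (by simp)
  have hoff : ∀ γ δ, γ ≠ δ → B γ δ = F / 3 := by
    intro γ δ hne
    have hd0 := hdiag' γ
    have hn1 : ‖(EuclideanSpace.single γ (1:ℝ) + EuclideanSpace.single δ (1:ℝ) : EuclideanSpace ℝ (Fin m))‖ = √2 := by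
      rw [norm_add_eq_sqrt_iff_real_inner_eq_zero.2]
      · simp; norm_num
      · simp [EuclideanSpace.inner_single_left, hne]
    have hn2 : ‖(EuclideanSpace.single γ (1:ℝ) - EuclideanSpace.single δ (1:ℝ) : EuclideanSpace ℝ (Fin m))‖ = √2 := by
      rw [norm_sub_eq_sqrt_iff_real_inner_eq_zero.2]
      · simp; norm_num
      · simp [EuclideanSpace.inner_single_left, hne]
    have hn3 : ‖(EuclideanSpace.single γ (√2) : EuclideanSpace ℝ (Fin m))‖ = √2 := by
      simp
    have e1 := aux_rot w 4 _ _ (hn1.trans hn3.symm)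
    have e2 := aux_rot w 4 _ _ (hn2.trans hn3.symm)
    have e3 : ∫ ξ : EuclideanSpace ℝ (Fin m), w ‖ξ‖ *
      (inner ℝ (EuclideanSpace.single γ (√2)) ξ / ‖ξ‖) ^ 4 = 4 * B γ γ := by
      simp only [hB]
      rw [← integral_const_mul]
      congr 1
      ext ξ
      have h4 : √2 ^ 4 = 4 := by
        rw [show (4:ℕ) = 2 * 2 by rfl, pow_mul, Real.sq_sqrt (by norm_num)]; norm_num
      simp only [EuclideanSpace.inner_single_left, div_pow, mul_pow, conj_trivial, h4]
      ring
    have hi1 := aux_int2 w hw γ γ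
    have hi2 := aux_int2 w hw γ δ
    have hi3 := aux_int2 w hw δ δ
    have e4 : ∫ ξ : EuclideanSpace ℝ (Fin m), (w ‖ξ‖ *
      (inner ℝ (EuclideanSpace.single γ (1:ℝ) + EuclideanSpace.single δ (1:ℝ)) ξ / ‖ξ‖) ^ 4
      + w ‖ξ‖ *
      (inner ℝ (EuclideanSpace.single γ (1:ℝ) - EuclideanSpace.single δ (1:ℝ)) ξ / ‖ξ‖) ^ 4)
      = 2 * B γ γ + 12 * B γ δ + 2 * B δ δ := by
      simp only [hB]
      rw [← integral_const_mul, ← integral_const_mul, ← integral_const_mul,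
        ← integral_add (hi1.const_mul _) (hi2.const_mul _),
        ← integral_add ((hi1.const_mul _).fun_add (hi2.const_mul _)) (hi3.const_mul _)]
      congr 1
      ext ξ
      simp [EuclideanSpace.inner_single_left, inner_add_left, inner_sub_left]
      ring
    rw [integral_add, e1, e2, e3, hdiag, hdiag] at e4
    · linarith
    all_goals
      refine Integrable.mul_bdd (c := 4) hw (aux_meas _ _).aestronglyMeasurable ?_
      refine Filter.Eventually.of_forall fun ξ => ?_
      rw [Real.norm_of_nonneg (by positivity)]
      first
      | have h := abs_real_inner_le_norm (EuclideanSpace.single γ (1:ℝ) + EuclideanSpace.single δ (1:ℝ) : EuclideanSpace ℝ (Fin m)) ξ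
        rw [hn1] at h
        have h2 : |inner ℝ (EuclideanSpace.single γ (1:ℝ) + EuclideanSpace.single δ (1:ℝ) : EuclideanSpace ℝ (Fin m)) ξ / ‖ξ‖| ≤ √2 := by
          rw [abs_div, abs_norm]
          exact div_le_of_le_mul₀ (norm_nonneg _) (by positivity) h
        have h3 := pow_le_pow_left₀ (abs_nonneg _) h2 4
        rw [show √2 ^ 4 = 4 by rw [show (4:ℕ) = 2 * 2 by rfl, pow_mul, Real.sq_sqrt (by norm_num)]; norm_num] at h3
        rwa [Even.pow_abs (by decide)] at h3
      | have h := abs_real_inner_le_norm (EuclideanSpace.single γ (1:ℝ) - EuclideanSpace.single δ (1:ℝ) : EuclideanSpace ℝ (Fin m)) ξ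
        rw [hn2] at h
        have h2 : |inner ℝ (EuclideanSpace.single γ (1:ℝ) - EuclideanSpace.single δ (1:ℝ) : EuclideanSpace ℝ (Fin m)) ξ / ‖ξ‖| ≤ √2 := by
          rw [abs_div, abs_norm]
          exact div_le_of_le_mul₀ (norm_nonneg _) (by positivity) h
        have h3 := pow_le_pow_left₀ (abs_nonneg _) h2 4
        rw [show √2 ^ 4 = 4 by rw [show (4:ℕ) = 2 * 2 by rfl, pow_mul, Real.sq_sqrt (by norm_num)]; norm_num] at h3
        rwa [Even.pow_abs (by decide)] at h3
  have hall : ∀ γ δ, B γ δ = (F / 3) * (1 + if γ = δ then 2 else 0) := by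
    intro γ δ
    split_ifs with h
    · subst h; rw [hdiag]; ring
    · rw [hoff _ _ h]; ring
  have hs : ∑ δ, B α δ = (∫ ξ : EuclideanSpace ℝ (Fin m), w ‖ξ‖) / m := by
    rw [← aux_A hm w hw α]
    simp only [hB]
    rw [← integral_finsetSum _ (fun δ _ => aux_int2 w hw α δ)]
    apply integral_congr_ae
    filter_upwards [aux_ae hm] with ξ hξ
    rw [← Finset.mul_sum, aux_sum ξ hξ, mul_one]
  have hmpos : (0 : ℝ) < m := by positivity
  have hF' : F / 3 = (∫ ξ : EuclideanSpace ℝ (Fin m), w ‖ξ‖) / (m * (m + 2)) := by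
    rw [Finset.sum_congr rfl (fun δ _ => hall α δ), ← Finset.mul_sum, Finset.sum_add_distrib] at hs
    simp at hs
    rw [← div_div, ← hs]
    field_simp
  change B α β = _
  rw [hall, hF']
  ring

lemma aux_J (hm : 2 ≤ m) (k : ℕ) (hk : k < m) :
    Integrable (fun ξ : EuclideanSpace ℝ (Fin m) => Real.exp (-‖ξ‖) * (1 / ‖ξ‖) ^ k) ∧
    ∫ ξ : EuclideanSpace ℝ (Fin m), Real.exp (-‖ξ‖) * (1 / ‖ξ‖) ^ k
      = 2 * Real.pi ^ ((m : ℝ) / 2) / Real.Gamma ((m : ℝ) / 2) * Real.Gamma ((m : ℝ) - k) := by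
  have : Nonempty (Fin m) := ⟨⟨0, by omega⟩⟩
  have hkm : (0:ℝ) < (m:ℝ) - k := by
    have : (k:ℝ) < m := by exact_mod_cast hk
    linarith
  have hpt : ∀ y ∈ Set.Ioi (0:ℝ), Real.exp (-y) * y ^ ((m:ℝ) - k - 1)
      = y ^ (m - 1) • (Real.exp (-y) * (1 / y) ^ k) := by
    intro y hy
    have hy : 0 < y := hy
    have : ((m:ℝ) - k - 1) = ((m - 1 : ℕ) : ℝ) - (k:ℝ) := by
      rw [Nat.cast_sub (by omega)]; push_cast; ring
    rw [this, Real.rpow_sub hy, Real.rpow_natCast, Real.rpow_natCast, smul_eq_mul, one_div, inv_pow]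
    ring
  constructor
  · rw [integrable_fun_norm_addHaar volume (f := fun y => Real.exp (-y) * (1 / y) ^ k)]
    rw [finrank_euclideanSpace_fin]
    exact (Real.GammaIntegral_convergent hkm).congr_fun hpt measurableSet_Ioi
  · rw [integral_fun_norm_addHaar volume (fun y => Real.exp (-y) * (1 / y) ^ k),
      finrank_euclideanSpace_fin, ← setIntegral_congr_fun measurableSet_Ioi hpt,
      ← Real.Gamma_eq_integral hkm, Measure.real, EuclideanSpace.volume_ball]
    have hm0 : (0:ℝ) < (m:ℝ)/2 := by positivity
    have hG := Real.Gamma_pos_of_pos hm0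
    rw [Fintype.card_fin, Real.Gamma_add_one hm0.ne']
    rw [ENNReal.ofReal_one, one_pow, one_mul, ENNReal.toReal_ofReal (by positivity)]
    have : √π ^ m = π ^ ((m:ℝ)/2) := by
      rw [Real.sqrt_eq_rpow, ← Real.rpow_natCast, ← Real.rpow_mul Real.pi_pos.le]
      congr 1; ring
    rw [this]
    simp only [nsmul_eq_mul, smul_eq_mul]
    field_simp

lemma aux_lin (hm : 2 ≤ m) (w : ℝ → ℝ)
    (hw : Integrable (fun ξ : EuclideanSpace ℝ (Fin m) => w ‖ξ‖)) (a : Fin m → ℝ) :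
    Integrable (fun ξ : EuclideanSpace ℝ (Fin m) => w ‖ξ‖ * ∑ α, a α * ((ξ α) ^ 2 / ‖ξ‖ ^ 2)) ∧
    ∫ ξ : EuclideanSpace ℝ (Fin m), w ‖ξ‖ * ∑ α, a α * ((ξ α) ^ 2 / ‖ξ‖ ^ 2)
      = (∑ α, a α) * ((∫ ξ : EuclideanSpace ℝ (Fin m), w ‖ξ‖) / m) := by
  have heq : (fun ξ : EuclideanSpace ℝ (Fin m) => w ‖ξ‖ * ∑ α, a α * ((ξ α) ^ 2 / ‖ξ‖ ^ 2))
      = fun ξ => ∑ α, a α * (w ‖ξ‖ * ((ξ α) ^ 2 / ‖ξ‖ ^ 2)) := by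
    ext ξ
    rw [Finset.mul_sum]
    exact Finset.sum_congr rfl fun _ _ => by ring
  have hi : ∀ α ∈ Finset.univ, Integrable (fun ξ : EuclideanSpace ℝ (Fin m) =>
      a α * (w ‖ξ‖ * ((ξ α) ^ 2 / ‖ξ‖ ^ 2))) := fun α _ => (aux_int w hw α).const_mul _
  rw [heq]
  refine ⟨integrable_finsetSum _ hi, ?_⟩
  rw [integral_finsetSum _ hi, Finset.sum_mul]
  refine Finset.sum_congr rfl fun α _ => ?_
  rw [integral_const_mul, aux_A hm w hw]

lemma aux_quad (hm : 2 ≤ m) (w : ℝ → ℝ)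
    (hw : Integrable (fun ξ : EuclideanSpace ℝ (Fin m) => w ‖ξ‖)) (a : Fin m → ℝ) :
    Integrable (fun ξ : EuclideanSpace ℝ (Fin m) =>
      w ‖ξ‖ * (∑ α, a α * ((ξ α) ^ 2 / ‖ξ‖ ^ 2)) ^ 2) ∧
    ∫ ξ : EuclideanSpace ℝ (Fin m), w ‖ξ‖ * (∑ α, a α * ((ξ α) ^ 2 / ‖ξ‖ ^ 2)) ^ 2
      = ((∑ α, a α) ^ 2 + 2 * ∑ α, a α ^ 2)
        * ((∫ ξ : EuclideanSpace ℝ (Fin m), w ‖ξ‖) / (m * (m + 2))) := by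
  have heq : (fun ξ : EuclideanSpace ℝ (Fin m) =>
        w ‖ξ‖ * (∑ α, a α * ((ξ α) ^ 2 / ‖ξ‖ ^ 2)) ^ 2)
      = fun ξ => ∑ α, ∑ β, a α * a β *
        (w ‖ξ‖ * ((ξ α) ^ 2 / ‖ξ‖ ^ 2) * ((ξ β) ^ 2 / ‖ξ‖ ^ 2)) := by
    ext ξ
    rw [sq, Finset.sum_mul_sum, Finset.mul_sum]
    refine Finset.sum_congr rfl fun _ _ => ?_
    rw [Finset.mul_sum]
    exact Finset.sum_congr rfl fun _ _ => by ring
  have hi : ∀ α, ∀ β ∈ Finset.univ, Integrable (fun ξ : EuclideanSpace ℝ (Fin m) =>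
      a α * a β * (w ‖ξ‖ * ((ξ α) ^ 2 / ‖ξ‖ ^ 2) * ((ξ β) ^ 2 / ‖ξ‖ ^ 2))) :=
    fun α β _ => (aux_int2 w hw α β).const_mul _
  have hi' := fun α (_ : α ∈ Finset.univ) => integrable_finsetSum Finset.univ (hi α)
  rw [heq]
  refine ⟨integrable_finsetSum _ hi', ?_⟩
  rw [integral_finsetSum _ hi']
  set K := (∫ ξ : EuclideanSpace ℝ (Fin m), w ‖ξ‖) / (m * (m + 2)) with hK
  have h1 : ∀ α, ∫ ξ : EuclideanSpace ℝ (Fin m), ∑ β, a α * a β *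
        (w ‖ξ‖ * ((ξ α) ^ 2 / ‖ξ‖ ^ 2) * ((ξ β) ^ 2 / ‖ξ‖ ^ 2))
      = (a α * (∑ β, a β) + 2 * a α ^ 2) * K := by
    intro α
    rw [integral_finsetSum _ (hi α)]
    simp_rw [integral_const_mul, aux_B hm w hw, ← hK]
    have : ∀ β, a α * a β * ((1 + if α = β then 2 else 0) * K)
        = a α * K * a β + (if α = β then 2 * a α * a β * K else 0) := by
      intro β; split_ifs <;> ring
    simp_rw [this]
    rw [Finset.sum_add_distrib, ← Finset.mul_sum]
    simp
    ring
  simp_rw [h1]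
  rw [← Finset.sum_mul, Finset.sum_add_distrib, ← Finset.sum_mul, ← Finset.mul_sum]
  ring

end helpers

/-- Evaluation of the normal part `a_{2,n}` of the second Steklov heat invariant: with
`m = n-1`, principal curvatures `l`, `c_α = g_{αα,nn}`, `d_α = g^{αα,nn}` satisfying
`Σ d = 8 Σ l² - Σ c`, the integral of the normal integrand `b_n` equals the stated
combination of `(Σ l)²`, `Σ l²` and `Σ c`. Here `V_m = 2π^{m/2}/Γ(m/2)`. -/
theorem integral_a2_normal (n : ℕ) (hn : 3 ≤ n) (m : ℕ) (hm : m = n - 1)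
    (l c d : Fin m → ℝ)
    (hd : ∑ α, d α = 8 * ∑ α, (l α) ^ 2 - ∑ α, c α) :
    ∫ ξ : EuclideanSpace ℝ (Fin m), Real.exp (-‖ξ‖) *
        ((1 / 8) * (1 + 1 / ‖ξ‖) *
            ∑ α, ∑ β, l α * l β * (1 - (ξ α) ^ 2 / ‖ξ‖ ^ 2) * (1 - (ξ β) ^ 2 / ‖ξ‖ ^ 2)
          + (1 / (2 * ‖ξ‖ ^ 5)) * ∑ α, ∑ β, l α * l β * (ξ α) ^ 2 * (ξ β) ^ 2
          - (1 / (8 * ‖ξ‖ ^ 3)) * ∑ α, d α * (ξ α) ^ 2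
          + (1 / (2 * ‖ξ‖)) * ∑ α, (l α) ^ 2
          - (1 / (8 * ‖ξ‖)) * ∑ α, c α
          - (1 / (4 * ‖ξ‖)) * ∑ α, ∑ β, l α * l β * (1 - (ξ β) ^ 2 / ‖ξ‖ ^ 2))
      = ((2 * Real.pi ^ ((m : ℝ) / 2) / Real.Gamma ((m : ℝ) / 2))
            * Real.Gamma ((n : ℝ) - 2) / 8) *
          (((n : ℝ) - 5 + 2 / ((n : ℝ) - 1) + ((n : ℝ) + 3) / ((n : ℝ) ^ 2 - 1))
              * (∑ α, l α) ^ 2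
            + ((2 * (n : ℝ) + 6) / ((n : ℝ) ^ 2 - 1) + 4 - 8 / ((n : ℝ) - 1))
              * ∑ α, (l α) ^ 2
            - (((n : ℝ) - 2) / ((n : ℝ) - 1)) * ∑ α, c α) := by
  have hm2 : 2 ≤ m := by omega
  obtain ⟨i0, j0⟩ := aux_J hm2 0 (by omega)
  obtain ⟨i1, j1⟩ := aux_J hm2 1 (by omega)
  set V := 2 * Real.pi ^ ((m : ℝ) / 2) / Real.Gamma ((m : ℝ) / 2) with hV
  obtain ⟨a0, A0⟩ := aux_lin hm2 (fun r => Real.exp (-r) * (1 / r) ^ 0) i0 l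
  obtain ⟨a1, A1⟩ := aux_lin hm2 (fun r => Real.exp (-r) * (1 / r) ^ 1) i1 l
  obtain ⟨d1, D1⟩ := aux_lin hm2 (fun r => Real.exp (-r) * (1 / r) ^ 1) i1 d
  obtain ⟨q0, Q0⟩ := aux_quad hm2 (fun r => Real.exp (-r) * (1 / r) ^ 0) i0 l
  obtain ⟨q1, Q1⟩ := aux_quad hm2 (fun r => Real.exp (-r) * (1 / r) ^ 1) i1 l
  have hmn : (n : ℝ) = m + 1 := by
    have : n = m + 1 := by omega
    exact_mod_cast this
  have hmR : (2 : ℝ) ≤ m := by exact_mod_cast hm2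
  have hG : Real.Gamma (m : ℝ) = ((m : ℝ) - 1) * Real.Gamma ((m : ℝ) - 1) := by
    have := Real.Gamma_add_one (s := (m : ℝ) - 1) (by linarith)
    rwa [sub_add_cancel] at this
  rw [Nat.cast_zero, sub_zero, hG] at j0
  rw [Nat.cast_one] at j1
  rw [j0] at A0 Q0
  rw [j1] at A1 D1 Q1
  set G := Real.Gamma ((m : ℝ) - 1) with hGd
  have hn2 : (n : ℝ) - 2 = (m : ℝ) - 1 := by rw [hmn]; ring
  rw [hn2, ← hGd]
  set L := ∑ α, l α with hL
  set Q := ∑ α, (l α) ^ 2 with hQ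
  set C := ∑ α, c α with hC
  have key : ∀ ξ : EuclideanSpace ℝ (Fin m), Real.exp (-‖ξ‖) *
        ((1 / 8) * (1 + 1 / ‖ξ‖) *
            ∑ α, ∑ β, l α * l β * (1 - (ξ α) ^ 2 / ‖ξ‖ ^ 2) * (1 - (ξ β) ^ 2 / ‖ξ‖ ^ 2)
          + (1 / (2 * ‖ξ‖ ^ 5)) * ∑ α, ∑ β, l α * l β * (ξ α) ^ 2 * (ξ β) ^ 2
          - (1 / (8 * ‖ξ‖ ^ 3)) * ∑ α, d α * (ξ α) ^ 2
          + (1 / (2 * ‖ξ‖)) * Q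
          - (1 / (8 * ‖ξ‖)) * C
          - (1 / (4 * ‖ξ‖)) * ∑ α, ∑ β, l α * l β * (1 - (ξ β) ^ 2 / ‖ξ‖ ^ 2))
      = (L ^ 2 / 8) * (Real.exp (-‖ξ‖) * (1 / ‖ξ‖) ^ 0)
        + (-(L / 4)) * (Real.exp (-‖ξ‖) * (1 / ‖ξ‖) ^ 0 * ∑ α, l α * ((ξ α) ^ 2 / ‖ξ‖ ^ 2))
        + (1 / 8) * (Real.exp (-‖ξ‖) * (1 / ‖ξ‖) ^ 0 * (∑ α, l α * ((ξ α) ^ 2 / ‖ξ‖ ^ 2)) ^ 2)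
        + (-(L ^ 2 / 8) + Q / 2 - C / 8) * (Real.exp (-‖ξ‖) * (1 / ‖ξ‖) ^ 1)
        + (5 / 8) * (Real.exp (-‖ξ‖) * (1 / ‖ξ‖) ^ 1 * (∑ α, l α * ((ξ α) ^ 2 / ‖ξ‖ ^ 2)) ^ 2)
        + (-(1 / 8)) * (Real.exp (-‖ξ‖) * (1 / ‖ξ‖) ^ 1 * ∑ α, d α * ((ξ α) ^ 2 / ‖ξ‖ ^ 2)) := by
    intro ξ
    set P := ∑ α, l α * ((ξ α) ^ 2 / ‖ξ‖ ^ 2) with hP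
    have hLP : ∑ β, l β * (1 - (ξ β) ^ 2 / ‖ξ‖ ^ 2) = L - P := by
      rw [hL, hP, ← Finset.sum_sub_distrib]
      exact Finset.sum_congr rfl fun _ _ => by ring
    have e1 : ∑ α, ∑ β, l α * l β * (1 - (ξ α) ^ 2 / ‖ξ‖ ^ 2) * (1 - (ξ β) ^ 2 / ‖ξ‖ ^ 2)
        = (L - P) ^ 2 := by
      rw [← hLP, pow_two (∑ β, l β * (1 - (ξ β) ^ 2 / ‖ξ‖ ^ 2)), Finset.sum_mul_sum]
      exact Finset.sum_congr rfl fun _ _ => Finset.sum_congr rfl fun _ _ => by ring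
    have e2 : (1 / (2 * ‖ξ‖ ^ 5)) * ∑ α, ∑ β, l α * l β * (ξ α) ^ 2 * (ξ β) ^ 2
        = (1 / 2) * (1 / ‖ξ‖) * P ^ 2 := by
      rw [pow_two P, hP, Finset.sum_mul_sum, Finset.mul_sum, Finset.mul_sum]
      refine Finset.sum_congr rfl fun _ _ => ?_
      rw [Finset.mul_sum, Finset.mul_sum]
      refine Finset.sum_congr rfl fun _ _ => ?_
      ring
    have e3 : (1 / (8 * ‖ξ‖ ^ 3)) * ∑ α, d α * (ξ α) ^ 2
        = (1 / 8) * (1 / ‖ξ‖) * ∑ α, d α * ((ξ α) ^ 2 / ‖ξ‖ ^ 2) := by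
      rw [Finset.mul_sum, Finset.mul_sum]
      refine Finset.sum_congr rfl fun _ _ => ?_
      ring
    have e4 : ∑ α, ∑ β, l α * l β * (1 - (ξ β) ^ 2 / ‖ξ‖ ^ 2) = L * (L - P) := by
      rw [← hLP, hL, Finset.sum_mul_sum]
      exact Finset.sum_congr rfl fun _ _ => Finset.sum_congr rfl fun _ _ => by ring
    rw [e1, e2, e3, e4]
    ring
  rw [integral_congr_ae (Filter.Eventually.of_forall key)]
  have I1 := i0.const_mul (L ^ 2 / 8)
  have I2 := a0.const_mul (-(L / 4))
  have I3 := q0.const_mul (1 / 8)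
  have I4 := i1.const_mul (-(L ^ 2 / 8) + Q / 2 - C / 8)
  have I5 := q1.const_mul (5 / 8)
  have I6 := d1.const_mul (-(1 / 8))
  rw [integral_add ((((I1.fun_add I2).fun_add I3).fun_add I4).fun_add I5) I6,
    integral_add (((I1.fun_add I2).fun_add I3).fun_add I4) I5,
    integral_add ((I1.fun_add I2).fun_add I3) I4,
    integral_add (I1.fun_add I2) I3, integral_add I1 I2]
  simp only [integral_const_mul]
  rw [j0, j1, A0, Q0, Q1, D1, hd, hmn]
  have h1 : (m : ℝ) ≠ 0 := by linarith
  have h2 : (m : ℝ) + 2 ≠ 0 := by linarith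
  have h3 : ((m : ℝ) + 1) ^ 2 - 1 = m * (m + 2) := by ring
  have h4 : (m : ℝ) + 1 - 1 = m := by ring
  rw [h3, h4]
  field_simp
  ring
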